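/- Let n ≥ 1 and let V : ℝ × ℝⁿ → ℝ be C^∞ and sub-quadratic with exponent ρ ∈ [1,2). Let K ⊂ ℝⁿ be compact, a ≥ 1, t₀ > 0 and 0 < p < 1. For x ∈ K, ξ ∈ ℝⁿ and λ ≥ 1, define the Picard iterates x^{(0)}(s) = x + (s − t₀) λ ξ and x^{(N+1)}(s) = x + (s − t₀) λ ξ − ∫_{t₀}^{s} (s − s₁) ∇_x V(s₁, x^{(N)}(s₁)) ds₁ for N ≥ 0. Then there exists λ₀ ≥ 1 such that for every N ≥ 0, every λ ≥ λ₀, every x ∈ K, every ξ with a^{−1} ≤ |ξ| ≤ a, and every s ∈ [0, t₀] with t₀ − s ≥ λ^{p−1}: (1/(2a)) (t₀ − s) λ ≤ | x^{(N)}(s) | ≤ 2a (t₀ − s) λ. -/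

import Mathlib

open MeasureTheory Complex
open scoped InnerProductSpace BigOperators

noncomputable section

/-- `ℝⁿ` as a Euclidean space. -/
abbrev Euc (n : ℕ) := EuclideanSpace ℝ (Fin n)

variable {n : ℕ}

/-- Wave packet transform `W_φ f (x, ξ) = ∫ conj (φ (y - x)) f y e^{-i y·ξ} dy`. -/
def WPT (φ f : Euc n → ℂ) (x ξ : Euc n) : ℂ :=
  ∫ y, (starRingEnd ℂ) (φ (y - x)) * f y * Complex.exp (-Complex.I * ((⟪y, ξ⟫_ℝ : ℝ) : ℂ))

/-- Fourier transform `f̂(ξ) = ∫ e^{-i y·ξ} f y dy`. -/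
def FT (f : Euc n → ℂ) (ξ : Euc n) : ℂ :=
  ∫ y, Complex.exp (-Complex.I * ((⟪y, ξ⟫_ℝ : ℝ) : ℂ)) * f y

/-- Free Schrödinger evolution `U₀(t) f (x) = (2π)^{-n} ∫ e^{i(x·ξ - t|ξ|²/2)} f̂(ξ) dξ`. -/
def U0 (t : ℝ) (f : Euc n → ℂ) (x : Euc n) : ℂ :=
  (((2 * Real.pi) ^ n)⁻¹ : ℝ) •
    ∫ ξ, Complex.exp (Complex.I * ((⟪x, ξ⟫_ℝ - t * ‖ξ‖ ^ 2 / 2 : ℝ) : ℂ)) * FT f ξ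

/-- Dilation `(φ)_λ(x) = λ^{n b / 2} φ (λ^b x)` (with `λ^b` a real power). -/
def dilate (b lam : ℝ) (φ : Euc n → ℂ) : Euc n → ℂ :=
  fun x => ((lam ^ ((n : ℝ) * b / 2) : ℝ) : ℂ) * φ ((lam ^ b : ℝ) • x)

/-- `V` is smooth and sub-quadratic with exponent `ρ`:
`|∂_x^α V(t,x)| ≤ C_α (1+|x|)^{ρ-|α|}` for all multi-indices `α`. -/
def SubQuadratic (ρ : ℝ) (V : ℝ × Euc n → ℝ) : Prop :=
  ContDiff ℝ (⊤ : ℕ∞) V ∧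
    ∀ k : ℕ, ∃ C : ℝ, 0 < C ∧ ∀ (t : ℝ) (x : Euc n),
      ‖iteratedFDeriv ℝ k (fun z => V (t, z)) x‖ ≤ C * (1 + ‖x‖) ^ (ρ - (k : ℝ))

/-- Gradient of `V` in the `x` variable. -/
def gradV (V : ℝ × Euc n → ℝ) (t : ℝ) (x : Euc n) : Euc n :=
  gradient (fun z => V (t, z)) x

/-- `(X, Ξ)` solves the Hamilton equations `ẋ = ξ`, `ξ̇ = -∇ₓ V`. -/
def IsHamiltonSol (V : ℝ × Euc n → ℝ) (X Ξ : ℝ → Euc n) : Prop :=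
  (∀ s, HasDerivAt X (Ξ s) s) ∧ (∀ s, HasDerivAt Ξ (-gradV V s (X s)) s)

/-- `Γ` is a conic neighborhood of `ξ₀`. -/
def IsConicNbhd (Γ : Set (Euc n)) (ξ₀ : Euc n) : Prop :=
  Γ ∈ nhds ξ₀ ∧ ∀ ξ ∈ Γ, ∀ c : ℝ, 0 < c → c • ξ ∈ Γ

/-- `(x₀, ξ₀)` is not in the wave front set of the (locally integrable) function `f`. -/
def NotInWF (f : Euc n → ℂ) (x₀ ξ₀ : Euc n) : Prop :=
  ∃ χ : Euc n → ℝ, ContDiff ℝ (⊤ : ℕ∞) χ ∧ HasCompactSupport χ ∧ χ x₀ ≠ 0 ∧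
    ∃ Γ₀ : Set (Euc n), IsConicNbhd Γ₀ ξ₀ ∧
      ∀ N : ℕ, ∃ C : ℝ, 0 < C ∧ ∀ ξ ∈ Γ₀,
        ‖∫ y, (χ y : ℂ) * f y * Complex.exp (-Complex.I * ((⟪y, ξ⟫_ℝ : ℝ) : ℂ))‖ ≤
          C * (1 + ‖ξ‖) ^ (-(N : ℝ))

/-- `∂_t Φ` for `Φ : ℝ × ℝⁿ → ℂ`. -/
def tDerivP (Φ : ℝ × Euc n → ℂ) (p : ℝ × Euc n) : ℂ :=
  fderiv ℝ Φ p ((1 : ℝ), (0 : Euc n))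

/-- `∂_{x_j} Φ` for `Φ : ℝ × ℝⁿ → ℂ`. -/
def xPartialP (j : Fin n) (Φ : ℝ × Euc n → ℂ) (p : ℝ × Euc n) : ℂ :=
  fderiv ℝ (fun z => Φ (p.1, z)) p.2 (EuclideanSpace.single j 1)

/-- Laplacian in the `x` variable of `Φ : ℝ × ℝⁿ → ℂ`. -/
def xLaplacianP (Φ : ℝ × Euc n → ℂ) (p : ℝ × Euc n) : ℂ :=
  ∑ j : Fin n, xPartialP j (fun q => xPartialP j Φ q) p

/-- `u` is a distributional solution of `i ∂_t u + (1/2) Δ u - V u = 0`: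
`∬ u (−i∂_tΦ + (1/2)ΔΦ − VΦ) dx dt = 0` for every test function `Φ`. -/
def IsDistSol (V : ℝ × Euc n → ℝ) (u : ℝ → Euc n → ℂ) : Prop :=
  ∀ Φ : ℝ × Euc n → ℂ, ContDiff ℝ (⊤ : ℕ∞) Φ → HasCompactSupport Φ →
    (∫ p : ℝ × Euc n, u p.1 p.2 *
        (-Complex.I * tDerivP Φ p + (1 / 2 : ℂ) * xLaplacianP Φ p - ((V p : ℝ) : ℂ) * Φ p)) = 0

/-- `∂_{y_j} g` for `g : ℝⁿ → ℂ`. -/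
def partialD (j : Fin n) (g : Euc n → ℂ) : Euc n → ℂ :=
  fun y => fderiv ℝ g y (EuclideanSpace.single j 1)

/-- Laplacian of `g : ℝⁿ → ℂ`. -/
def lapl (g : Euc n → ℂ) : Euc n → ℂ :=
  fun y => ∑ j : Fin n, partialD j (partialD j g) y

/-- Multi-index derivative `∂^α g`. -/
def multiPartial (α : Fin n → ℕ) (g : Euc n → ℂ) : Euc n → ℂ :=
  ((List.ofFn fun j : Fin n => (partialD j)^[α j]).foldr (· ∘ ·) id) g


/-- The gradient of a sub-quadratic potential grows at most like `|x|^{ρ-1}`. -/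
theorem SubQuadratic.exists_norm_gradV_le {ρ : ℝ} {V : ℝ × Euc n → ℝ} (hV : SubQuadratic ρ V) :
    ∃ C : ℝ, 0 < C ∧ ∀ (t : ℝ) (x : Euc n), ‖gradV V t x‖ ≤ C * (1 + ‖x‖) ^ (ρ - 1) := by
  obtain ⟨C, hC, h⟩ := hV.2 1
  refine ⟨C, hC, fun t x => ?_⟩
  have := h t x
  rwa [norm_iteratedFDeriv_one, Nat.cast_one,
    ← (InnerProductSpace.toDual ℝ (Euc n)).symm.norm_map] at this

/-- An affine function of `lam` raised to a power less than one is eventually below `ε * lam`. -/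
theorem eventually_mul_affine_rpow_le {σ A B C ε : ℝ} (hσ0 : 0 ≤ σ) (hσ1 : σ < 1)
    (hA : 0 ≤ A) (hB : 0 ≤ B) (hC : 0 ≤ C) (hε : 0 < ε) :
    ∀ᶠ lam : ℝ in Filter.atTop, C * (A + B * lam) ^ σ ≤ ε * lam := by
  filter_upwards [Filter.eventually_ge_atTop 1,
    (tendsto_rpow_atTop (sub_pos.2 hσ1)).eventually_ge_atTop (C * (A + B) ^ σ / ε)] with lam h1 h2
  have hlam : 0 < lam := by linarith
  calc C * (A + B * lam) ^ σ ≤ C * ((A + B) * lam) ^ σ := by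
        gcongr
        nlinarith
    _ = C * (A + B) ^ σ * lam ^ σ := by
        rw [Real.mul_rpow (by positivity) hlam.le, mul_assoc]
    _ ≤ ε * lam ^ (1 - σ) * lam ^ σ := by
        gcongr ?_ * lam ^ σ
        rwa [div_le_iff₀' hε] at h2
    _ = ε * lam := by
        rw [mul_assoc, ← Real.rpow_add hlam, sub_add_cancel, Real.rpow_one]

/-- A double time integral of a field bounded by `G` on `[s, t₀]` is at most `(t₀ - s)² G`. -/
theorem norm_integral_sub_smul_le {E : Type*} [NormedAddCommGroup E] [NormedSpace ℝ E]
    {F : ℝ → E} {G s t₀ : ℝ} (hs : s ≤ t₀) (hF : ∀ r ∈ Set.Icc s t₀, ‖F r‖ ≤ G) :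
    ‖∫ r in t₀..s, (s - r) • F r‖ ≤ (t₀ - s) * G * (t₀ - s) := by
  have hbound : ∀ r ∈ Set.uIoc t₀ s, ‖(s - r) • F r‖ ≤ (t₀ - s) * G := by
    intro r hr
    rw [Set.uIoc_of_ge hs] at hr
    rw [norm_smul, Real.norm_eq_abs, abs_of_nonpos (by linarith [hr.1])]
    exact mul_le_mul (by linarith [hr.2]) (hF r ⟨hr.1.le, hr.2⟩) (norm_nonneg _) (by linarith)
  have := intervalIntegral.norm_integral_le_of_norm_le_const hbound
  rwa [abs_of_nonpos (by linarith), neg_sub] at this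

/-- If the field is small compared with `lam` on the relevant ball, then every Picard iterate
stays within `(t₀ - s) * lam / (4 * a)` of the free motion. -/
theorem norm_picard_sub_free_le {V : ℝ × Euc n → ℝ} {σ C R a t₀ lam : ℝ} {x ξ : Euc n}
    (hσ : 0 ≤ σ) (hC : 0 < C) (hgrad : ∀ t y, ‖gradV V t y‖ ≤ C * (1 + ‖y‖) ^ σ)
    (hx : ‖x‖ ≤ R) (ha : 1 ≤ a) (hξ : ‖ξ‖ ≤ a) (ht₀ : 0 < t₀) (hlam : 1 ≤ lam)
    (hsmall : t₀ * C * ((1 + R) + 2 * a * t₀ * lam) ^ σ ≤ (4 * a)⁻¹ * lam)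
    {xN : ℕ → ℝ → Euc n} (h0 : ∀ s : ℝ, xN 0 s = x + (s - t₀) • (lam • ξ))
    (hsucc : ∀ (N : ℕ) (s : ℝ), xN (N + 1) s = x + (s - t₀) • (lam • ξ)
      - ∫ s₁ in t₀..s, (s - s₁) • gradV V s₁ (xN N s₁)) (N : ℕ) :
    ∀ s ∈ Set.Icc (0 : ℝ) t₀,
      ‖xN N s - (x + (s - t₀) • (lam • ξ))‖ ≤ (4 * a)⁻¹ * ((t₀ - s) * lam) := by
  have ha0 : 0 < a := by linarith
  induction N with
  | zero =>
    intro s hs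
    have : 0 ≤ t₀ - s := by linarith [hs.2]
    rw [h0, sub_self, norm_zero]
    positivity
  | succ N ih =>
    intro s hs
    have hts : 0 ≤ t₀ - s := by linarith [hs.2]
    rw [hsucc, sub_sub_cancel_left, norm_neg]
    have hF : ∀ r ∈ Set.Icc s t₀,
        ‖gradV V r (xN N r)‖ ≤ C * ((1 + R) + 2 * a * t₀ * lam) ^ σ := by
      intro r hr
      refine (hgrad r _).trans ?_
      have hr0 : 0 ≤ t₀ - r := by linarith [hr.2]
      have hrt : t₀ - r ≤ t₀ := by linarith [hr.1, hs.1]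
      have hfree : ‖(r - t₀) • (lam • ξ)‖ ≤ t₀ * (lam * a) := by
        rw [norm_smul, norm_smul, Real.norm_eq_abs, Real.norm_eq_abs,
          abs_of_nonpos (by linarith), abs_of_nonneg (by linarith : 0 ≤ lam), neg_sub]
        gcongr
      have hdev : (4 * a)⁻¹ * ((t₀ - r) * lam) ≤ a * (t₀ * lam) := by
        gcongr
        exact (inv_le_one_of_one_le₀ (by linarith)).trans ha
      have htri : ‖xN N r‖ ≤ ‖xN N r - (x + (r - t₀) • (lam • ξ))‖ +
          (‖x‖ + ‖(r - t₀) • (lam • ξ)‖) := by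
        refine (norm_le_norm_sub_add _ (x + (r - t₀) • (lam • ξ))).trans ?_
        gcongr
        exact norm_add_le _ _
      have := ih r ⟨hs.1.trans hr.1, hr.2⟩
      gcongr C * ?_ ^ σ
      linarith
    calc _ ≤ (t₀ - s) * (C * ((1 + R) + 2 * a * t₀ * lam) ^ σ) * (t₀ - s) :=
          norm_integral_sub_smul_le hs.2 hF
      _ ≤ t₀ * (C * ((1 + R) + 2 * a * t₀ * lam) ^ σ) * (t₀ - s) := by
          have : 0 ≤ R := (norm_nonneg x).trans hx
          gcongr
          linarith [hs.1]
      _ ≤ (4 * a)⁻¹ * lam * (t₀ - s) := by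
          rw [← mul_assoc]
          gcongr
      _ = _ := by ring

/-- Uniform two-sided estimates for the Picard iterates
`x^{(0)}(s) = x + (s - t₀)λξ`,
`x^{(N+1)}(s) = x + (s - t₀)λξ - ∫_{t₀}^s (s - s₁) ∇ₓV(s₁, x^{(N)}(s₁)) ds₁`. -/
theorem picard_iterates_estimate (hn : 1 ≤ n) (V : ℝ × Euc n → ℝ) (ρ : ℝ)
    (hρ1 : 1 ≤ ρ) (hρ2 : ρ < 2) (hV : SubQuadratic ρ V)
    (K : Set (Euc n)) (hK : IsCompact K) (a : ℝ) (ha : 1 ≤ a)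
    (t₀ : ℝ) (ht₀ : 0 < t₀) (p : ℝ) (hp0 : 0 < p) (hp1 : p < 1) :
    ∃ lam₀ : ℝ, 1 ≤ lam₀ ∧
      ∀ lam : ℝ, lam₀ ≤ lam → ∀ x ∈ K, ∀ ξ : Euc n, a⁻¹ ≤ ‖ξ‖ → ‖ξ‖ ≤ a →
        ∀ xN : ℕ → ℝ → Euc n,
          (∀ s : ℝ, xN 0 s = x + (s - t₀) • (lam • ξ)) →
          (∀ (N : ℕ) (s : ℝ), xN (N + 1) s =
              x + (s - t₀) • (lam • ξ)
                - ∫ s₁ in t₀..s, (s - s₁) • gradV V s₁ (xN N s₁)) →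
          ∀ N : ℕ, ∀ s ∈ Set.Icc (0 : ℝ) t₀, lam ^ (p - 1) ≤ t₀ - s →
            (1 / (2 * a)) * (t₀ - s) * lam ≤ ‖xN N s‖ ∧
              ‖xN N s‖ ≤ 2 * a * (t₀ - s) * lam := by
  obtain ⟨C, hC, hgrad⟩ := hV.exists_norm_gradV_le
  obtain ⟨R, hR0, hR⟩ := hK.isBounded.exists_pos_norm_le
  have ha0 : 0 < a := by linarith
  obtain ⟨lam₀, hlam₀⟩ := Filter.eventually_atTop.1
    ((eventually_mul_affine_rpow_le (σ := ρ - 1) (A := 1 + R) (B := 2 * a * t₀) (C := t₀ * C)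
      (ε := (4 * a)⁻¹) (by linarith) (by linarith) (by positivity) (by positivity)
      (by positivity) (by positivity)).and
      ((tendsto_rpow_atTop hp0).eventually_ge_atTop (R * (4 * a))))
  refine ⟨max 1 lam₀, le_max_left _ _, ?_⟩
  intro lam hlam x hx ξ hξ1 hξ2 xN h0 hsucc N s hs hps
  have hlam1 : 1 ≤ lam := (le_max_left _ _).trans hlam
  have hlam_pos : 0 < lam := by linarith
  obtain ⟨hsmall, hRlam⟩ := hlam₀ lam ((le_max_right _ _).trans hlam)
  have hdev := norm_picard_sub_free_le (by linarith) hC hgrad (hR x hx) ha hξ2 ht₀ hlam1 hsmall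
    h0 hsucc N s hs
  have hts : 0 ≤ t₀ - s := by linarith [hs.2]
  have hpow : lam ^ p ≤ (t₀ - s) * lam := by
    calc lam ^ p = lam ^ (p - 1) * lam := by
          rw [Real.rpow_sub_one hlam_pos.ne', div_mul_cancel₀ _ hlam_pos.ne']
      _ ≤ _ := by gcongr
  set τ := (t₀ - s) * lam with hτ
  have hτ0 : 0 ≤ τ := by positivity
  have hxτ : ‖x‖ ≤ (4 * a)⁻¹ * τ := by
    rw [inv_mul_eq_div, le_div_iff₀ (by positivity)]
    have := mul_le_mul_of_nonneg_right (hR x hx) (by positivity : 0 ≤ 4 * a)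
    linarith
  have hfree : ‖(s - t₀) • (lam • ξ)‖ = τ * ‖ξ‖ := by
    rw [norm_smul, norm_smul, Real.norm_eq_abs, Real.norm_eq_abs,
      abs_of_nonpos (by linarith), abs_of_pos hlam_pos, neg_sub, hτ, mul_assoc]
  have hclose : ‖xN N s - (s - t₀) • (lam • ξ)‖ ≤ 2 * ((4 * a)⁻¹ * τ) := by
    have : xN N s - (s - t₀) • (lam • ξ) =
        xN N s - (x + (s - t₀) • (lam • ξ)) + x := by abel
    rw [this]
    linarith [norm_add_le (xN N s - (x + (s - t₀) • (lam • ξ))) x]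
  have hhalf : 2 * ((4 * a)⁻¹ * τ) = 1 / (2 * a) * τ := by
    field_simp
    norm_num
  rw [hhalf] at hclose
  rw [mul_assoc, mul_assoc (2 * a), ← hτ]
  constructor
  · have hinv : a⁻¹ * τ = 2 * (1 / (2 * a) * τ) := by field_simp
    have := mul_le_mul_of_nonneg_left hξ1 hτ0
    have := norm_sub_norm_le ((s - t₀) • (lam • ξ)) (xN N s)
    rw [norm_sub_rev] at this
    linarith
  · have : 1 / (2 * a) * τ ≤ a * τ := by
      gcongr
      exact ((div_le_one (by positivity)).2 (by linarith)).trans ha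
    have := mul_le_mul_of_nonneg_left hξ2 hτ0
    have := norm_le_norm_sub_add (xN N s) ((s - t₀) • (lam • ξ))
    linarith

end
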